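/- arXiv:math/0211421 — 14 statements merged into one kernel-verified Lean document; each statement's English description precedes it below -/
import Mathlib

section
/- Let a, b, x be positive real numbers and let w = arcosh((cosh x + cosh a · cosh b)/(sinh a · sinh b)). Then w ≤ 1/a + 1/b + x + 2·log 2. -/
noncomputable def arcosh (x : ℝ) : ℝ := Real.log (x + Real.sqrt (x ^ 2 - 1))

noncomputable def coth (x : ℝ) : ℝ := Real.cosh x / Real.sinh x

theorem cosh_le_aux (a : ℝ) (ha : 0 < a) :
    Real.cosh a ≤ Real.exp (1 / a) * Real.sinh a := by
  have h1 : a < Real.sinh a := Real.self_lt_sinh_iff.2 ha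
  have h2 : Real.cosh a - Real.sinh a = Real.exp (-a) := Real.cosh_sub_sinh a
  have h3 : Real.exp (-a) ≤ 1 := Real.exp_le_one_iff.2 (by linarith)
  have h4 : 1 / a + 1 ≤ Real.exp (1 / a) := Real.add_one_le_exp _
  have h5 : 1 ≤ 1 / a * Real.sinh a := by
    rw [one_div, inv_mul_eq_div, le_div_iff₀ ha]; linarith
  nlinarith

theorem stmt_0 (a b x : ℝ) (ha : 0 < a) (hb : 0 < b) (hx : 0 < x)
    (w : ℝ)
    (hw : w = arcosh ((Real.cosh x + Real.cosh a * Real.cosh b) / (Real.sinh a * Real.sinh b))) :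
    w ≤ 1 / a + 1 / b + x + 2 * Real.log 2 := by
  have sa : 0 < Real.sinh a := Real.sinh_pos_iff.2 ha
  have sb : 0 < Real.sinh b := Real.sinh_pos_iff.2 hb
  have ca := Real.one_le_cosh a
  have cb := Real.one_le_cosh b
  have cx := Real.one_le_cosh x
  have hex : Real.cosh x ≤ Real.exp x := by
    have := Real.cosh_sub_sinh x
    have h := Real.cosh_add_sinh x
    have : 0 < Real.sinh x := Real.sinh_pos_iff.2 hx
    linarith
  have hC : 1 ≤ Real.cosh a * Real.cosh b := one_le_mul_of_one_le_of_one_le ca cb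
  have hCE : Real.cosh a * Real.cosh b ≤
      (Real.exp (1 / a) * Real.sinh a) * (Real.exp (1 / b) * Real.sinh b) :=
    mul_le_mul (cosh_le_aux a ha) (cosh_le_aux b hb) (by linarith) (by positivity)
  set X := (Real.cosh x + Real.cosh a * Real.cosh b) / (Real.sinh a * Real.sinh b) with hX
  have hX0 : 0 < X := by positivity
  have hXle : X ≤ 2 * (Real.exp (1 / a) * Real.exp (1 / b) * Real.exp x) := by
    rw [hX, div_le_iff₀ (by positivity)]
    have h1 : Real.cosh x + Real.cosh a * Real.cosh b ≤
        2 * Real.exp x * (Real.cosh a * Real.cosh b) := by nlinarith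
    have h2 := mul_le_mul_of_nonneg_left hCE (by positivity : 0 ≤ 2 * Real.exp x)
    linarith
  have hs : Real.sqrt (X ^ 2 - 1) ≤ X := by
    rw [Real.sqrt_le_left hX0.le]; linarith
  rw [hw, arcosh, Real.log_le_iff_le_exp (by positivity)]
  have h2 : 2 * Real.log 2 = Real.log 2 + Real.log 2 := by ring
  rw [h2, Real.exp_add, Real.exp_add, Real.exp_add, Real.exp_add, Real.exp_log (by norm_num)]
  linarith
end

section
/- Let a, b, x be positive real numbers, let w = arcosh((cosh x + cosh a · cosh b)/(sinh a · sinh b)), and let h = arcosh(sinh b · sinh w) (the argument sinh b · sinh w is greater than 1). Then h ≤ 1/a + 1/b + b + x + log 2. -/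
theorem stmt_1 (a b x : ℝ) (ha : 0 < a) (hb : 0 < b) (hx : 0 < x)
    (w h : ℝ)
    (hw : w = arcosh ((Real.cosh x + Real.cosh a * Real.cosh b) / (Real.sinh a * Real.sinh b)))
    (hh : h = arcosh (Real.sinh b * Real.sinh w)) :
    h ≤ 1 / a + 1 / b + b + x + Real.log 2 := by
  have hsa : a ≤ Real.sinh a := Real.self_le_sinh_iff.2 ha.le
  have hsb : b ≤ Real.sinh b := Real.self_le_sinh_iff.2 hb.le
  have hA : 0 < Real.sinh a := by linarith
  have hB : 0 < Real.sinh b := by linarith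
  have hca : Real.cosh a ≤ Real.sinh a + 1 := by
    have := Real.cosh_sub_sinh a
    have : Real.exp (-a) ≤ 1 := Real.exp_le_one_iff.2 (by linarith)
    linarith
  have hcx : Real.cosh x ≤ Real.exp x := by
    have := Real.cosh_add_sinh x
    have := Real.sinh_pos_iff.2 hx
    linarith
  have harg : 1 < (Real.cosh x + Real.cosh a * Real.cosh b) / (Real.sinh a * Real.sinh b) := by
    rw [one_lt_div (by positivity)]
    have h1 := mul_lt_mul'' (Real.sinh_lt_cosh a) (Real.sinh_lt_cosh b) hA.le hB.le
    have := Real.cosh_pos x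
    linarith
  have hwpos : 0 < w := by rw [hw]; exact Real.arcosh_pos harg
  have hcw : Real.cosh w = (Real.cosh x + Real.cosh a * Real.cosh b) / (Real.sinh a * Real.sinh b) := by
    rw [hw]; exact Real.cosh_arcosh harg.le
  have hsw : 0 < Real.sinh w := Real.sinh_pos_iff.2 hwpos
  have hX : 1 ≤ Real.exp x := Real.one_le_exp hx.le
  have hcb1 : 1 ≤ Real.cosh b := Real.one_le_cosh b
  have hcb : 1 + Real.cosh b ≤ Real.exp b * (1 / b + 1) := by
    have h1 : Real.exp (-b) ≤ 1 := Real.exp_le_one_iff.2 (by linarith)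
    have h2 : b + 1 ≤ Real.exp b := Real.add_one_le_exp b
    have h3 : (b + 1) * (1 / b + 1 / 2) ≤ Real.exp b * (1 / b + 1 / 2) := by gcongr
    have h4 : (b + 1) * (1 / b + 1 / 2) = 3 / 2 + 1 / b + b / 2 := by field_simp; ring
    have h5 : 0 < 1 / b := by positivity
    rw [Real.cosh_eq]
    linarith
  have hs : Real.sinh b * Real.sinh w ≤ Real.exp (1 / a + 1 / b + b + x) := by
    have e1 : Real.sinh b * Real.sinh w ≤ (Real.cosh x + Real.cosh a * Real.cosh b) / Real.sinh a := by
      calc _ ≤ Real.sinh b * Real.cosh w := by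
            gcongr; exact (Real.sinh_lt_cosh w).le
        _ = _ := by rw [hcw]; field_simp
    have e2 : (Real.cosh x + Real.cosh a * Real.cosh b) / Real.sinh a
        ≤ Real.exp x * ((1 / a + 1) * (1 + Real.cosh b)) := by
      have p1 : (Real.cosh x + Real.cosh a * Real.cosh b) / Real.sinh a
        ≤ (Real.exp x + (Real.sinh a + 1) * Real.cosh b) / Real.sinh a := by gcongr
      have p2 : (Real.exp x + (Real.sinh a + 1) * Real.cosh b) / Real.sinh a
        = 1 / Real.sinh a * (Real.exp x + Real.cosh b) + Real.cosh b := by field_simp; ring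
      have p3 : 1 / Real.sinh a * (Real.exp x + Real.cosh b) ≤ 1 / a * (Real.exp x + Real.cosh b) := by
        gcongr
      have p4 : Real.cosh b ≤ Real.exp x * Real.cosh b := by nlinarith
      have p5 : 1 / a * (Real.exp x + Real.cosh b) ≤ 1 / a * (Real.exp x + Real.exp x * Real.cosh b) := by
        gcongr
      nlinarith
    have e3 : Real.exp x * ((1 / a + 1) * (1 + Real.cosh b))
       ≤ Real.exp x * (Real.exp (1 / a) * (Real.exp b * Real.exp (1 / b))) := by
      gcongr
      · exact Real.add_one_le_exp _
      · refine hcb.trans ?_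
        gcongr
        exact Real.add_one_le_exp _
    refine (e1.trans (e2.trans e3)).trans (le_of_eq ?_)
    rw [← Real.exp_add, ← Real.exp_add, ← Real.exp_add]
    congr 1; ring
  have hspos : 0 < Real.sinh b * Real.sinh w := by positivity
  rw [hh]
  unfold arcosh
  set s := Real.sinh b * Real.sinh w
  have hq : Real.sqrt (s ^ 2 - 1) ≤ s := Real.sqrt_le_iff.2 ⟨hspos.le, by linarith⟩
  have hq0 := Real.sqrt_nonneg (s ^ 2 - 1)
  rw [Real.log_le_iff_le_exp (by linarith), Real.exp_add _ (Real.log 2), Real.exp_log (by norm_num)]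
  linarith
end

section
/- Let b, w be positive real numbers with sinh b · sinh w ≥ 1. Then arcosh(sinh b · sinh w) ≤ b + w − log 2. -/
theorem stmt_3 (b w : ℝ) (hb : 0 < b) (hw : 0 < w)
    (h1 : 1 ≤ Real.sinh b * Real.sinh w) :
    arcosh (Real.sinh b * Real.sinh w) ≤ b + w - Real.log 2 := by
  have hsb : 0 < Real.sinh b := Real.sinh_pos_iff.2 hb
  have hsw : 0 < Real.sinh w := Real.sinh_pos_iff.2 hw
  have hB : Real.exp b = Real.cosh b + Real.sinh b := (Real.cosh_add_sinh b).symm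
  have hW : Real.exp w = Real.cosh w + Real.sinh w := (Real.cosh_add_sinh w).symm
  have hcb := Real.cosh_sq b
  have hcw := Real.cosh_sq w
  have hlb := Real.sinh_lt_cosh b
  have hlw := Real.sinh_lt_cosh w
  unfold arcosh
  have hE : Real.exp (b + w - Real.log 2) = Real.exp b * Real.exp w / 2 := by
    rw [Real.exp_sub, Real.exp_add, Real.exp_log (by norm_num)]
  rw [Real.log_le_iff_le_exp (by positivity), hE]
  have hB0 := Real.exp_pos b
  have hW0 := Real.exp_pos w
  have e1 : 2 * Real.sinh b * Real.exp b = Real.exp b ^ 2 - 1 := by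
    rw [hB]; nlinarith
  have e2 : 2 * Real.sinh w * Real.exp w = Real.exp w ^ 2 - 1 := by
    rw [hW]; nlinarith
  have b1 : 2 * Real.sinh b ≤ Real.exp b := by linarith
  have b2 : 2 * Real.sinh w ≤ Real.exp w := by linarith
  generalize Real.exp b = B at *
  generalize Real.exp w = W at *
  generalize Real.sinh b = s at *
  generalize Real.sinh w = t at *
  have hx : (2 * s) * (2 * t) ≤ B * W := by gcongr
  have hp : 0 < s * t := by positivity
  have key : √((s * t) ^ 2 - 1) ≤ B * W / 2 - s * t := by
    apply Real.sqrt_le_iff.2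
    refine ⟨by linarith, ?_⟩
    have e3 : 4 * (s * t * (B * W)) = (B ^ 2 - 1) * (W ^ 2 - 1) := by
      rw [← e1, ← e2]; ring
    nlinarith [sq_nonneg B, sq_nonneg W]
  linarith
end

section
/- Fix positive reals a and b and for x > 0 set y(x) = arcosh((cosh a + cosh b·cosh x)/(sinh b·sinh x)) and z(x) = arcosh((cosh b + cosh a·cosh x)/(sinh a·sinh x)). Then for every x > 0 the function y is differentiable at x with derivative y'(x) = − coth(z(x)) / sinh x. -/
theorem arcosh_eq_real (x : ℝ) : arcosh x = Real.arcosh x := rfl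

theorem hex_gt_one (a b x : ℝ) (hb : 0 < b) (hx : 0 < x) :
    1 < (Real.cosh a + Real.cosh b * Real.cosh x) / (Real.sinh b * Real.sinh x) := by
  have h1 := Real.sinh_pos_iff.2 hb
  have h2 := Real.sinh_pos_iff.2 hx
  rw [lt_div_iff₀ (by positivity)]
  have h3 := Real.cosh_pos (b - x)
  rw [Real.cosh_sub] at h3
  have := Real.cosh_pos a
  linarith

theorem hex_sqrt (a b x : ℝ) (hb : 0 < b) (hx : 0 < x) :
    Real.sqrt (((Real.cosh a + Real.cosh b * Real.cosh x) / (Real.sinh b * Real.sinh x)) ^ 2 - 1)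
      = Real.sqrt (Real.cosh a ^ 2 + Real.cosh b ^ 2 + Real.cosh x ^ 2
          + 2 * (Real.cosh a * Real.cosh b * Real.cosh x) - 1)
        / (Real.sinh b * Real.sinh x) := by
  have h1 := Real.sinh_pos_iff.2 hb
  have h2 := Real.sinh_pos_iff.2 hx
  have h3 : 0 < Real.sinh b * Real.sinh x := by positivity
  rw [← Real.sqrt_sq h3.le, ← Real.sqrt_div' _ (by positivity), Real.sqrt_sq h3.le]
  congr 1
  rw [div_pow, eq_div_iff (by positivity), sub_mul, div_mul_cancel₀ _ (by positivity), mul_pow,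
    Real.sinh_sq, Real.sinh_sq]
  ring

theorem stmt_4 (a b : ℝ) (ha : 0 < a) (hb : 0 < b) :
    ∀ x > (0 : ℝ),
      HasDerivAt
        (fun x : ℝ =>
          arcosh ((Real.cosh a + Real.cosh b * Real.cosh x) / (Real.sinh b * Real.sinh x)))
        (-(coth (arcosh ((Real.cosh b + Real.cosh a * Real.cosh x) / (Real.sinh a * Real.sinh x)))
            / Real.sinh x)) x := by
  intro x hx
  have h1 := Real.sinh_pos_iff.2 hb
  have h2 := Real.sinh_pos_iff.2 hx
  have h0 := Real.sinh_pos_iff.2 ha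
  have hY := hex_gt_one a b x hb hx
  have hZ := hex_gt_one b a x ha hx
  have hd := (((Real.hasDerivAt_cosh x).const_mul (Real.cosh b)).const_add (Real.cosh a)).div
    ((Real.hasDerivAt_sinh x).const_mul (Real.sinh b)) (by positivity)
  have key := (Real.hasDerivAt_arcosh (Set.mem_Ioi.2 hY)).comp x hd
  refine HasDerivAt.congr_deriv key ?_
  rw [arcosh_eq_real, coth, Real.cosh_arcosh hZ.le, Real.sinh_arcosh hZ.le,
    hex_sqrt a b x hb hx, hex_sqrt b a x ha hx]
  have hD : Real.cosh b ^ 2 + Real.cosh a ^ 2 + Real.cosh x ^ 2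
      + 2 * (Real.cosh b * Real.cosh a * Real.cosh x) - 1
      = Real.cosh a ^ 2 + Real.cosh b ^ 2 + Real.cosh x ^ 2
      + 2 * (Real.cosh a * Real.cosh b * Real.cosh x) - 1 := by ring
  rw [hD]
  have hpos : 0 < Real.sqrt (Real.cosh a ^ 2 + Real.cosh b ^ 2 + Real.cosh x ^ 2
      + 2 * (Real.cosh a * Real.cosh b * Real.cosh x) - 1) := by
    apply Real.sqrt_pos.2
    have := Real.one_le_cosh a
    have := Real.cosh_pos b
    have := Real.cosh_pos x
    have : 0 < Real.cosh a * Real.cosh b * Real.cosh x := by positivity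
    nlinarith [sq_nonneg (Real.cosh b), sq_nonneg (Real.cosh x)]
  generalize Real.sqrt _ = S at hpos ⊢
  have hs := Real.sinh_sq x
  generalize Real.sinh x = s at *
  generalize Real.sinh a = sa at *
  generalize Real.sinh b = sb at *
  field_simp
  rw [hs]
  ring
end

section
/- Fix positive reals a and b and for x > 0 set z(x) = arcosh((cosh b + cosh a·cosh x)/(sinh a·sinh x)) and w(x) = arcosh((cosh x + cosh a·cosh b)/(sinh a·sinh b)). Then for every x > 0 the function w is differentiable at x with derivative w'(x) = 1/(sinh a · sinh(z(x))). -/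
theorem arcosh_eq_aux : arcosh = Real.arcosh := by
  funext x
  rfl

theorem one_lt_aux {a b x : ℝ} (ha : 0 < a) (hb : 0 < b) :
    1 < (Real.cosh x + Real.cosh a * Real.cosh b) / (Real.sinh a * Real.sinh b) := by
  have h1 := Real.sinh_pos_iff.2 ha
  have h2 := Real.sinh_pos_iff.2 hb
  have h3 := Real.cosh_pos x
  have h4 := Real.sinh_lt_cosh a
  have h5 := Real.sinh_lt_cosh b
  rw [lt_div_iff₀ (mul_pos h1 h2)]
  nlinarith [mul_lt_mul'' h4 h5 h1.le h2.le]

theorem stmt_5 (a b : ℝ) (ha : 0 < a) (hb : 0 < b) :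
    ∀ x > (0 : ℝ),
      HasDerivAt
        (fun x : ℝ =>
          arcosh ((Real.cosh x + Real.cosh a * Real.cosh b) / (Real.sinh a * Real.sinh b)))
        (1 / (Real.sinh a *
          Real.sinh (arcosh ((Real.cosh b + Real.cosh a * Real.cosh x) / (Real.sinh a * Real.sinh x))))) x := by
  intro x hx
  have hW := one_lt_aux (x := x) ha hb
  have hZ := one_lt_aux (x := b) ha hx
  rw [arcosh_eq_aux, Real.sinh_arcosh hZ.le]
  have h1 := Real.sinh_pos_iff.2 ha
  have h2 := Real.sinh_pos_iff.2 hb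
  have h3 := Real.sinh_pos_iff.2 hx
  have hd := (Real.hasDerivAt_arcosh hW).comp x
    (((Real.hasDerivAt_cosh x).add_const (Real.cosh a * Real.cosh b)).div_const
      (Real.sinh a * Real.sinh b))
  refine hd.congr_deriv ?_
  have ea := Real.cosh_sq a
  have eb := Real.cosh_sq b
  have ex := Real.cosh_sq x
  set W := (Real.cosh x + Real.cosh a * Real.cosh b) / (Real.sinh a * Real.sinh b) with hWd
  set Z := (Real.cosh b + Real.cosh a * Real.cosh x) / (Real.sinh a * Real.sinh x) with hZd
  have pW : 0 < √(W ^ 2 - 1) := Real.sqrt_pos.2 (by nlinarith)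
  have pZ : 0 < √(Z ^ 2 - 1) := Real.sqrt_pos.2 (by nlinarith)
  have key : Real.sinh x * √(Z ^ 2 - 1) = Real.sinh b * √(W ^ 2 - 1) := by
    rw [← sq_eq_sq₀ (by positivity) (by positivity), mul_pow, mul_pow,
      Real.sq_sqrt (by nlinarith), Real.sq_sqrt (by nlinarith), hWd, hZd]
    field_simp
    ring_nf
    simp only [ea, eb, ex]
    ring
  field_simp
  linarith
end

section
/- Fix positive reals a and b and for x > 0 set y(x) = arcosh((cosh a + cosh b·cosh x)/(sinh b·sinh x)). Then for every x > 0 the derivative y'(x) satisfies y'(x) < 0 and |y'(x)| < coth x. -/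
theorem stmt_6 (a b : ℝ) (ha : 0 < a) (hb : 0 < b) :
    ∀ x > (0 : ℝ),
      DifferentiableAt ℝ
        (fun x : ℝ =>
          arcosh ((Real.cosh a + Real.cosh b * Real.cosh x) / (Real.sinh b * Real.sinh x))) x ∧
      deriv (fun x : ℝ =>
          arcosh ((Real.cosh a + Real.cosh b * Real.cosh x) / (Real.sinh b * Real.sinh x))) x < 0 ∧
      |deriv (fun x : ℝ =>
          arcosh ((Real.cosh a + Real.cosh b * Real.cosh x) / (Real.sinh b * Real.sinh x))) x| < coth x := by
  intro x hx
  have hS : 0 < Real.sinh x := Real.sinh_pos_iff.2 hx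
  have hT : 0 < Real.sinh b := Real.sinh_pos_iff.2 hb
  have hA : 1 ≤ Real.cosh a := Real.one_le_cosh a
  have hB : 1 ≤ Real.cosh b := Real.one_le_cosh b
  have hC : 1 < Real.cosh x := Real.one_lt_cosh.2 hx.ne'
  have hSC := Real.cosh_sq x
  have hTB := Real.cosh_sq b
  have hnum : HasDerivAt (fun x : ℝ => Real.cosh a + Real.cosh b * Real.cosh x)
      (Real.cosh b * Real.sinh x) x :=
    ((Real.hasDerivAt_cosh x).const_mul (Real.cosh b)).const_add (Real.cosh a)
  have hden : HasDerivAt (fun x : ℝ => Real.sinh b * Real.sinh x)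
      (Real.sinh b * Real.cosh x) x :=
    (Real.hasDerivAt_sinh x).const_mul (Real.sinh b)
  have hu1 : 1 < (Real.cosh a + Real.cosh b * Real.cosh x) / (Real.sinh b * Real.sinh x) := by
    rw [one_lt_div (by positivity)]
    have := Real.cosh_sub b x
    have := Real.one_le_cosh (b - x)
    linarith
  have hu := hnum.fun_div hden (by positivity)
  have hy := HasDerivAt.comp x (Real.hasDerivAt_arcosh hu1) hu
  change HasDerivAt (fun x : ℝ =>
          arcosh ((Real.cosh a + Real.cosh b * Real.cosh x) / (Real.sinh b * Real.sinh x))) _ x at hy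
  rw [hy.deriv]
  refine ⟨hy.differentiableAt, ?_⟩
  clear hy hu hnum hden
  have hr2 := Real.sq_sqrt (show 0 ≤ ((Real.cosh a + Real.cosh b * Real.cosh x) /
    (Real.sinh b * Real.sinh x)) ^ 2 - 1 by nlinarith)
  have hr := Real.sqrt_pos.2 (show 0 < ((Real.cosh a + Real.cosh b * Real.cosh x) /
    (Real.sinh b * Real.sinh x)) ^ 2 - 1 by nlinarith)
  generalize √(((Real.cosh a + Real.cosh b * Real.cosh x) /
    (Real.sinh b * Real.sinh x)) ^ 2 - 1) = r at *
  unfold coth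
  clear hu1
  generalize Real.cosh a = A at *
  generalize Real.cosh b = B at *
  generalize Real.cosh x = C at *
  generalize Real.sinh b = T at *
  generalize Real.sinh x = S at *
  have e : r⁻¹ * ((B * S * (T * S) - (A + B * C) * (T * C)) / (T * S) ^ 2)
      = - ((B + A * C) / (T * S ^ 2 * r)) := by
    field_simp
    linear_combination (-B) * hSC
  have hpos : 0 < (B + A * C) / (T * S ^ 2 * r) := by positivity
  rw [e, abs_neg, abs_of_pos hpos]
  refine ⟨by linarith, ?_⟩
  have hD : (T * S * r) ^ 2 = A ^ 2 + B ^ 2 + C ^ 2 + 2 * A * B * C - 1 := by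
    have : (T * S * r) ^ 2 = (A + B * C) ^ 2 - (T ^ 2) * (S ^ 2) := by
      rw [mul_pow, hr2]
      field_simp
    rw [this, show T ^ 2 = B ^ 2 - 1 by linarith, show S ^ 2 = C ^ 2 - 1 by linarith]
    ring
  have key : B + A * C < C * (T * S * r) := by
    apply lt_of_pow_lt_pow_left₀ 2 (by positivity)
    rw [mul_pow, hD]
    have : 0 < S ^ 2 * (B ^ 2 + C ^ 2 + 2 * A * B * C) := by positivity
    rw [show S ^ 2 = C ^ 2 - 1 by linarith] at this
    linarith
  rw [div_lt_div_iff₀ (by positivity) hS]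
  nlinarith
end

section
/- Fix positive reals a and b and for x > 0 set w(x) = arcosh((cosh x + cosh a·cosh b)/(sinh a·sinh b)). Then for every x > 0 the derivative w'(x) satisfies 0 < w'(x) < 1. -/
theorem stmt_7 (a b : ℝ) (ha : 0 < a) (hb : 0 < b) :
    ∀ x > (0 : ℝ),
      DifferentiableAt ℝ
        (fun x : ℝ =>
          arcosh ((Real.cosh x + Real.cosh a * Real.cosh b) / (Real.sinh a * Real.sinh b))) x ∧
      0 < deriv (fun x : ℝ =>
          arcosh ((Real.cosh x + Real.cosh a * Real.cosh b) / (Real.sinh a * Real.sinh b))) x ∧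
      deriv (fun x : ℝ =>
          arcosh ((Real.cosh x + Real.cosh a * Real.cosh b) / (Real.sinh a * Real.sinh b))) x < 1 := by
  intro x hx
  have hA := Real.cosh_pos a
  have hB := Real.cosh_pos b
  have hX := Real.cosh_pos x
  have hSa := Real.sinh_pos_iff.2 ha
  have hSb := Real.sinh_pos_iff.2 hb
  have hSx := Real.sinh_pos_iff.2 hx
  have h1 := Real.cosh_sq a
  have h2 := Real.cosh_sq b
  have h3 := Real.cosh_sq x
  have hP : 0 < Real.sinh a * Real.sinh b := mul_pos hSa hSb
  have hlt : Real.sinh a * Real.sinh b < Real.cosh a * Real.cosh b :=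
    mul_lt_mul'' (Real.sinh_lt_cosh a) (Real.sinh_lt_cosh b) hSa.le hSb.le
  have hu : 1 < (Real.cosh x + Real.cosh a * Real.cosh b) / (Real.sinh a * Real.sinh b) := by
    rw [lt_div_iff₀ hP]; linarith
  have hd : HasDerivAt (fun x : ℝ =>
      (Real.cosh x + Real.cosh a * Real.cosh b) / (Real.sinh a * Real.sinh b))
      (Real.sinh x / (Real.sinh a * Real.sinh b)) x :=
    ((Real.hasDerivAt_cosh x).add_const _).div_const _
  have hac : arcosh = Real.arcosh := rfl
  have hD := (Real.hasDerivAt_arcosh hu).comp x hd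
  rw [← hac] at hD
  change HasDerivAt (fun x : ℝ => arcosh
    ((Real.cosh x + Real.cosh a * Real.cosh b) / (Real.sinh a * Real.sinh b))) _ x at hD
  refine ⟨hD.differentiableAt, ?_⟩
  rw [hD.deriv]
  have hq : 0 < Real.sinh x / (Real.sinh a * Real.sinh b) := div_pos hSx hP
  have hs : Real.sinh x / (Real.sinh a * Real.sinh b) <
      √(((Real.cosh x + Real.cosh a * Real.cosh b) / (Real.sinh a * Real.sinh b)) ^ 2 - 1) := by
    apply Real.lt_sqrt_of_sq_lt
    rw [lt_sub_iff_add_lt, div_pow, div_pow, div_add_one (by positivity)]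
    apply div_lt_div_of_pos_right _ (by positivity)
    have e : (Real.sinh a * Real.sinh b) ^ 2 = (Real.cosh a ^ 2 - 1) * (Real.cosh b ^ 2 - 1) := by
      rw [h1, h2]; ring
    have hp : 0 < Real.cosh x * (Real.cosh a * Real.cosh b) := by positivity
    nlinarith [sq_nonneg (Real.cosh a), sq_nonneg (Real.cosh b)]
  have hs0 := hq.trans hs
  refine ⟨mul_pos (inv_pos.2 hs0) hq, ?_⟩
  rw [inv_mul_lt_iff₀ hs0, mul_one]
  exact hs
end

section
/- Let a, b, x be positive real numbers and let z = arcosh((cosh b + cosh a·cosh x)/(sinh a·sinh x)). Then cosh x > coth z and sinh x · sinh z > 1. -/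
theorem stmt_8 (a b x : ℝ) (ha : 0 < a) (hb : 0 < b) (hx : 0 < x)
    (z : ℝ)
    (hz : z = arcosh ((Real.cosh b + Real.cosh a * Real.cosh x) / (Real.sinh a * Real.sinh x))) :
    Real.cosh x > coth z ∧ Real.sinh x * Real.sinh z > 1 := by
  have hA : 0 < Real.sinh a := Real.sinh_pos_iff.2 ha
  have hS : 0 < Real.sinh x := Real.sinh_pos_iff.2 hx
  have hAC := Real.sinh_lt_cosh a
  have hSC := Real.sinh_lt_cosh x
  have hB := Real.cosh_pos b
  have hC := Real.cosh_pos x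
  have hCS := Real.cosh_sq x
  generalize ht : (Real.cosh b + Real.cosh a * Real.cosh x) / (Real.sinh a * Real.sinh x) = t at hz
  have htS : Real.cosh x < t * Real.sinh x := by
    have h : t * Real.sinh x = (Real.cosh b + Real.cosh a * Real.cosh x) / Real.sinh a := by
      rw [← ht]; field_simp
    rw [h, lt_div_iff₀ hA]
    nlinarith
  have ht1 : 1 < t := by
    by_contra! h
    nlinarith
  have hz' : z = Real.arcosh t := hz
  have hcz : Real.cosh z = t := by rw [hz', Real.cosh_arcosh ht1.le]
  have hzpos : 0 < z := by rw [hz']; exact Real.arcosh_pos ht1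
  have hs : 0 < Real.sinh z := Real.sinh_pos_iff.2 hzpos
  have hzz := Real.cosh_sq z
  have h2 : 1 < Real.sinh x * Real.sinh z := by
    have h3 : Real.cosh x ^ 2 < (t * Real.sinh x) ^ 2 := by gcongr
    have h4 : 1 ^ 2 < (Real.sinh x * Real.sinh z) ^ 2 := by
      rw [mul_pow, ← hcz, hzz] at h3
      rw [mul_pow]; linarith
    exact lt_of_pow_lt_pow_left₀ 2 (by positivity) h4
  refine ⟨?_, h2⟩
  unfold coth
  rw [gt_iff_lt, div_lt_iff₀ hs]
  apply lt_of_pow_lt_pow_left₀ 2 (by positivity)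
  rw [mul_pow, hzz, hCS]
  nlinarith
end

section
/- Let a, b, x be positive real numbers and let y = arcosh((cosh a + cosh b·cosh x)/(sinh b·sinh x)) and z = arcosh((cosh b + cosh a·cosh x)/(sinh a·sinh x)). Then cosh x > coth y · coth z. -/
theorem coth_aux (N S D : ℝ) (hS : 0 < S) (hN : 0 < N) (hD : 0 < D) (h : N ^ 2 - S ^ 2 = D) :
    coth (arcosh (N / S)) = N / Real.sqrt D := by
  have h1 : 1 ≤ N / S := by
    rw [le_div_iff₀ hS]
    nlinarith
  have e : arcosh (N / S) = Real.arcosh (N / S) := rfl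
  have h2 : (N / S) ^ 2 - 1 = D / S ^ 2 := by
    rw [← h]; field_simp
  rw [coth, e, Real.cosh_arcosh h1, Real.sinh_arcosh h1, h2, Real.sqrt_div hD.le,
    Real.sqrt_sq hS.le]
  have := Real.sqrt_pos.2 hD
  field_simp

theorem stmt_9 (a b x : ℝ) (ha : 0 < a) (hb : 0 < b) (hx : 0 < x)
    (y z : ℝ)
    (hy : y = arcosh ((Real.cosh a + Real.cosh b * Real.cosh x) / (Real.sinh b * Real.sinh x)))
    (hz : z = arcosh ((Real.cosh b + Real.cosh a * Real.cosh x) / (Real.sinh a * Real.sinh x))) :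
    Real.cosh x > coth y * coth z := by
  have sa := Real.sinh_pos_iff.2 ha
  have sb := Real.sinh_pos_iff.2 hb
  have sx := Real.sinh_pos_iff.2 hx
  have qa := Real.sinh_sq a
  have qb := Real.sinh_sq b
  have qx := Real.sinh_sq x
  have A1 := Real.one_lt_cosh.2 ha.ne'
  have B1 := Real.one_lt_cosh.2 hb.ne'
  have X1 := Real.one_lt_cosh.2 hx.ne'
  subst hy hz
  generalize Real.cosh a = A at *
  generalize Real.cosh b = B at *
  generalize Real.cosh x = X at *
  have hAB : 0 < A * B := by positivity
  have hD : 0 < A ^ 2 + B ^ 2 + X ^ 2 + 2 * A * B * X - 1 := by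
    have : 0 < 2 * A * B * X := by positivity
    nlinarith
  rw [coth_aux (A + B * X) (Real.sinh b * Real.sinh x) _ (by positivity) (by positivity) hD
      (by rw [mul_pow, qb, qx]; ring),
    coth_aux (B + A * X) (Real.sinh a * Real.sinh x) _ (by positivity) (by positivity) hD
      (by rw [mul_pow, qa, qx]; ring),
    div_mul_div_comm, Real.mul_self_sqrt hD.le, gt_iff_lt, div_lt_iff₀ hD]
  have : 0 < (X ^ 2 - 1) * (X + A * B) := mul_pos (by nlinarith) (by positivity)
  nlinarith
end

section
/- Let n, m be positive real numbers and γ ∈ (0, π). For real t with t < m define l(t) = arcosh(cosh n · cosh(m − t) − sinh n · sinh(m − t) · cos γ); the arcosh argument is greater than 1, and in particular l(0) > 0. Define α by cos α = (cosh m · cosh(l(0)) − cosh n)/(sinh m · sinh(l(0))). Then l is differentiable at 0 with l'(0) = − cos α. -/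
theorem stmt_12 (n m γ α : ℝ) (hn : 0 < n) (hm : 0 < m) (hγ : γ ∈ Set.Ioo 0 Real.pi)
    (l : ℝ → ℝ)
    (hl : ∀ t < m,
      l t = arcosh (Real.cosh n * Real.cosh (m - t) -
        Real.sinh n * Real.sinh (m - t) * Real.cos γ))
    (hα : Real.cos α =
      (Real.cosh m * Real.cosh (l 0) - Real.cosh n) / (Real.sinh m * Real.sinh (l 0))) :
    HasDerivAt l (-Real.cos α) 0 := by
  have hsn := Real.sinh_pos_iff.2 hn
  have hsm := Real.sinh_pos_iff.2 hm
  have hc : Real.cos γ < 1 := by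
    have := Real.cos_lt_cos_of_nonneg_of_le_pi le_rfl hγ.2.le hγ.1
    simpa using this
  have hA : 1 < Real.cosh n * Real.cosh m - Real.sinh n * Real.sinh m * Real.cos γ := by
    have h1 := Real.one_le_cosh (n - m)
    rw [Real.cosh_sub] at h1
    have h2 := mul_lt_mul_of_pos_left hc (mul_pos hsn hsm)
    linarith
  have harc : arcosh = Real.arcosh := rfl
  rw [harc] at hl
  have h0 := hl 0 hm
  rw [sub_zero] at h0
  have hS : 0 < Real.sinh (l 0) := by
    rw [h0]
    exact Real.sinh_pos_iff.2 (Real.arcosh_pos hA)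
  have hC := Real.cosh_arcosh hA.le
  have hS' := Real.sinh_arcosh hA.le
  rw [← h0] at hC hS'
  have hd : HasDerivAt (fun t : ℝ => m - t) (-1) 0 := by
    simpa using (hasDerivAt_id (0 : ℝ)).const_sub m
  have hf : HasDerivAt (fun t : ℝ => Real.cosh n * Real.cosh (m - t) -
      Real.sinh n * Real.sinh (m - t) * Real.cos γ)
      (Real.cosh n * (Real.sinh (m - 0) * (-1)) -
        Real.sinh n * (Real.cosh (m - 0) * (-1)) * Real.cos γ) 0 :=
    (hd.cosh.const_mul _).sub ((hd.sinh.const_mul _).mul_const _)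
  have hg := HasDerivAt.comp (0 : ℝ)
    (Real.hasDerivAt_arcosh (x := Real.cosh n * Real.cosh (m - 0) -
      Real.sinh n * Real.sinh (m - 0) * Real.cos γ) (by simpa using hA)) hf
  have he : l =ᶠ[nhds 0] (Real.arcosh ∘ fun t : ℝ => Real.cosh n * Real.cosh (m - t) -
      Real.sinh n * Real.sinh (m - t) * Real.cos γ) := by
    filter_upwards [Iio_mem_nhds hm] with t ht
    exact hl t ht
  refine (hg.congr_of_eventuallyEq he).congr_deriv ?_
  rw [hα, sub_zero, ← hS', hC]
  field_simp
  linear_combination Real.cosh n * Real.cosh_sq m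
end

section
/- Let c, e ≥ 0 and define, for t > 0, S(t) = arcosh(cosh c · cosh e · cosh t − sinh c · sinh e); the arcosh argument is greater than 1 for t > 0. Then for every t > 0, S is differentiable at t and 0 < S'(t) < coth(t/2). -/
theorem stmt_13 (c e : ℝ) (hc : 0 ≤ c) (he : 0 ≤ e) :
    ∀ t > (0 : ℝ),
      DifferentiableAt ℝ
        (fun t : ℝ =>
          arcosh (Real.cosh c * Real.cosh e * Real.cosh t - Real.sinh c * Real.sinh e)) t ∧
      0 < deriv (fun t : ℝ =>
          arcosh (Real.cosh c * Real.cosh e * Real.cosh t - Real.sinh c * Real.sinh e)) t ∧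
      deriv (fun t : ℝ =>
          arcosh (Real.cosh c * Real.cosh e * Real.cosh t - Real.sinh c * Real.sinh e)) t
        < coth (t / 2) := by
  intro t ht
  have hP : 0 < Real.cosh c * Real.cosh e := mul_pos (Real.cosh_pos c) (Real.cosh_pos e)
  have hD : 1 ≤ Real.cosh c * Real.cosh e - Real.sinh c * Real.sinh e := by
    rw [← Real.cosh_sub]; exact Real.one_le_cosh _
  set P := Real.cosh c * Real.cosh e
  set Q := Real.sinh c * Real.sinh e
  have hs : 0 < Real.sinh (t / 2) := Real.sinh_pos_iff.2 (by linarith)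
  have hk : 0 < Real.cosh (t / 2) := Real.cosh_pos _
  have hct : Real.cosh t = 1 + 2 * Real.sinh (t / 2) ^ 2 := by
    have h := Real.cosh_two_mul (t / 2)
    have h2 := Real.cosh_sq (t / 2)
    rw [show 2 * (t / 2) = t by ring] at h
    linarith
  have hst : Real.sinh t = 2 * Real.sinh (t / 2) * Real.cosh (t / 2) := by
    have h := Real.sinh_two_mul (t / 2)
    rwa [show 2 * (t / 2) = t by ring] at h
  have hPs : 0 < P * Real.sinh (t / 2) ^ 2 := by positivity
  have hX : 1 + 2 * (P * Real.sinh (t / 2) ^ 2) ≤ P * Real.cosh t - Q := by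
    rw [hct]; linarith
  have hsq : (2 * (P * Real.sinh (t / 2) ^ 2)) ^ 2 < (P * Real.cosh t - Q) ^ 2 - 1 := by
    nlinarith
  have hr : 2 * (P * Real.sinh (t / 2) ^ 2) < √((P * Real.cosh t - Q) ^ 2 - 1) :=
    Real.lt_sqrt_of_sq_lt hsq
  have hr0 : 0 < √((P * Real.cosh t - Q) ^ 2 - 1) := by linarith
  have harc : (arcosh : ℝ → ℝ) = Real.arcosh := rfl
  have hd : HasDerivAt (fun t : ℝ => arcosh (P * Real.cosh t - Q))
      ((√((P * Real.cosh t - Q) ^ 2 - 1))⁻¹ * (P * Real.sinh t)) t := by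
    rw [harc]
    exact HasDerivAt.comp t (h₂ := Real.arcosh) (h := fun t => P * Real.cosh t - Q)
      (Real.hasDerivAt_arcosh (show 1 < P * Real.cosh t - Q by linarith))
      (((Real.hasDerivAt_cosh t).const_mul P).sub_const Q)
  refine ⟨hd.differentiableAt, ?_, ?_⟩
  · rw [hd.deriv, hst]; positivity
  · rw [hd.deriv, hst, coth, inv_mul_eq_div, div_lt_div_iff₀ hr0 hs]
    nlinarith
end

section
/- Fix positive reals a, b and λ, μ ∈ (0, 1]. For x > 0 let y(x) = arcosh((cosh a + cosh b·cosh x)/(sinh b·sinh x)) and define S(x) = arcosh(cosh(μ·x) · cosh(λ·y(x))). Then for every x > 0, S is differentiable at x and |S'(x)| < coth x. -/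
theorem my_hasDerivAt_arcosh {x : ℝ} (hx : 1 < x) :
    HasDerivAt arcosh (√(x ^ 2 - 1))⁻¹ x := Real.hasDerivAt_arcosh hx

theorem y_deriv (a b x : ℝ) (hb : 0 < b) (hx : 0 < x) :
    ∃ d, HasDerivAt (fun x : ℝ => arcosh ((Real.cosh a + Real.cosh b * Real.cosh x) /
              (Real.sinh b * Real.sinh x))) d x ∧ d ≤ 0 ∧ -(Real.cosh x / Real.sinh x) < d := by
  have hs : 0 < Real.sinh x := Real.sinh_pos_iff.2 hx
  have ht : 0 < Real.sinh b := Real.sinh_pos_iff.2 hb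
  have hA : 0 < Real.cosh a := Real.cosh_pos a
  have hB : 0 < Real.cosh b := Real.cosh_pos b
  have hC : 0 < Real.cosh x := Real.cosh_pos x
  have hC2 := Real.cosh_sq x
  have hB2 := Real.cosh_sq b
  have hm := Real.cosh_sub b x
  have hm1 := Real.one_le_cosh (b - x)
  have hY : 1 < (Real.cosh a + Real.cosh b * Real.cosh x) / (Real.sinh b * Real.sinh x) := by
    rw [one_lt_div (by positivity)]; linarith
  have h1 : HasDerivAt (fun x : ℝ => (Real.cosh a + Real.cosh b * Real.cosh x) /
      (Real.sinh b * Real.sinh x))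
      (-(Real.cosh b + Real.cosh a * Real.cosh x) / (Real.sinh b * Real.sinh x ^ 2)) x := by
    have := (((Real.hasDerivAt_cosh x).const_mul (Real.cosh b)).const_add (Real.cosh a)).div
      ((Real.hasDerivAt_sinh x).const_mul (Real.sinh b)) (by positivity)
    refine HasDerivAt.congr_deriv this ?_
    field_simp
    linear_combination (-Real.cosh b) * hC2
  have h2 := (my_hasDerivAt_arcosh hY).comp x h1
  refine ⟨_, h2, ?_, ?_⟩
  · rw [neg_div, mul_neg, neg_nonpos]; positivity
  · have hr : 0 < ((Real.cosh a + Real.cosh b * Real.cosh x) /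
      (Real.sinh b * Real.sinh x)) ^ 2 - 1 := by nlinarith
    rw [neg_div, mul_neg, neg_lt_neg_iff, inv_mul_lt_iff₀ (Real.sqrt_pos.2 hr),
      ← div_lt_iff₀ (by positivity)]
    apply Real.lt_sqrt_of_sq_lt
    rw [← sub_pos]
    generalize Real.cosh a = A at *
    generalize Real.cosh b = B at *
    generalize Real.cosh x = C at *
    generalize Real.sinh x = s at *
    generalize Real.sinh b = t at *
    have : ((A + B * C) / (t * s)) ^ 2 - 1 - ((B + A * C) / (t * s ^ 2) / (C / s)) ^ 2
      = s ^ 2 * (B ^ 2 + C ^ 2 + 2 * A * B * C) / (t * s * C) ^ 2 := by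
      field_simp
      have e1 : s ^ 2 = C ^ 2 - 1 := by linarith
      have e2 : t ^ 2 = B ^ 2 - 1 := by linarith
      rw [e1, e2]; ring
    rw [this]; positivity

theorem stmt_15 (a b lam mu : ℝ) (ha : 0 < a) (hb : 0 < b)
    (hlam : lam ∈ Set.Ioc (0 : ℝ) 1) (hmu : mu ∈ Set.Ioc (0 : ℝ) 1) :
    ∀ x > (0 : ℝ),
      DifferentiableAt ℝ
        (fun x : ℝ =>
          arcosh (Real.cosh (mu * x) *
            Real.cosh (lam * arcosh ((Real.cosh a + Real.cosh b * Real.cosh x) /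
              (Real.sinh b * Real.sinh x))))) x ∧
      |deriv (fun x : ℝ =>
          arcosh (Real.cosh (mu * x) *
            Real.cosh (lam * arcosh ((Real.cosh a + Real.cosh b * Real.cosh x) /
              (Real.sinh b * Real.sinh x))))) x| < coth x := by
  intro x hx
  obtain ⟨d, hd, hd0, hd1⟩ := y_deriv a b x hb hx
  have hs : 0 < Real.sinh x := Real.sinh_pos_iff.2 hx
  have hy : 0 ≤ arcosh ((Real.cosh a + Real.cosh b * Real.cosh x) /
              (Real.sinh b * Real.sinh x)) := by
    apply Real.arcosh_nonneg
    have ht : 0 < Real.sinh b := Real.sinh_pos_iff.2 hb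
    have hm := Real.cosh_sub b x
    have hm1 := Real.one_le_cosh (b - x)
    have := Real.cosh_pos a
    rw [one_le_div (by positivity)]; linarith
  generalize hf : (fun x : ℝ => arcosh ((Real.cosh a + Real.cosh b * Real.cosh x) /
              (Real.sinh b * Real.sinh x))) = f at hd
  have hfx : ∀ x, arcosh ((Real.cosh a + Real.cosh b * Real.cosh x) /
              (Real.sinh b * Real.sinh x)) = f x := fun x => congrFun hf x
  simp only [hfx] at hy ⊢
  obtain ⟨hl0, hl1⟩ := hlam
  obtain ⟨hm0, hm1⟩ := hmu
  have hp : 1 < Real.cosh (mu * x) := Real.one_lt_cosh.2 (by positivity)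
  have hq : 1 ≤ Real.cosh (lam * f x) := Real.one_le_cosh _
  have hsp : 0 < Real.sinh (mu * x) := Real.sinh_pos_iff.2 (by positivity)
  have hsq : 0 ≤ Real.sinh (lam * f x) := Real.sinh_nonneg_iff.2 (by positivity)
  have hpq : 1 < Real.cosh (mu * x) * Real.cosh (lam * f x) := by nlinarith
  have e1 := Real.cosh_sq (mu * x)
  have e2 := Real.cosh_sq (lam * f x)
  have hD := (my_hasDerivAt_arcosh hpq).comp x
    ((((hasDerivAt_id x).const_mul mu).cosh).mul ((hd.const_mul lam).cosh))
  have hD' : HasDerivAt (fun x => arcosh (Real.cosh (mu * x) * Real.cosh (lam * f x))) _ x := hD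
  refine ⟨hD'.differentiableAt, ?_⟩
  rw [hD'.deriv]
  simp only [id, mul_one]
  have hR : 0 < √((Real.cosh (mu * x) * Real.cosh (lam * f x)) ^ 2 - 1) :=
    Real.sqrt_pos.2 (by nlinarith)
  have hu : Real.sinh (mu * x) * Real.cosh (lam * f x) ≤
      √((Real.cosh (mu * x) * Real.cosh (lam * f x)) ^ 2 - 1) := by
    apply Real.le_sqrt_of_sq_le
    rw [mul_pow, mul_pow, e1]; nlinarith
  have hv : Real.cosh (mu * x) * Real.sinh (lam * f x) ≤
      √((Real.cosh (mu * x) * Real.cosh (lam * f x)) ^ 2 - 1) := by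
    apply Real.le_sqrt_of_sq_le
    rw [mul_pow, mul_pow, e2]; nlinarith
  have hu0 : 0 ≤ Real.sinh (mu * x) * Real.cosh (lam * f x) := by positivity
  have hv0 : 0 ≤ Real.cosh (mu * x) * Real.sinh (lam * f x) := by positivity
  have hc : 1 < Real.cosh x / Real.sinh x := by
    rw [one_lt_div hs]; exact Real.sinh_lt_cosh x
  unfold coth
  generalize √((Real.cosh (mu * x) * Real.cosh (lam * f x)) ^ 2 - 1) = R at *
  generalize Real.cosh x / Real.sinh x = K at *
  have key : R⁻¹ * (Real.sinh (mu * x) * mu * Real.cosh (lam * f x) +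
      Real.cosh (mu * x) * (Real.sinh (lam * f x) * (lam * d)))
      = mu * ((Real.sinh (mu * x) * Real.cosh (lam * f x)) / R) +
        lam * ((Real.cosh (mu * x) * Real.sinh (lam * f x)) / R) * d := by
    field_simp
  rw [key]
  have u0 := div_nonneg hu0 hR.le
  have v0 := div_nonneg hv0 hR.le
  have u1 := (div_le_one hR).2 hu
  have v1 := (div_le_one hR).2 hv
  generalize (Real.sinh (mu * x) * Real.cosh (lam * f x)) / R = u at *
  generalize (Real.cosh (mu * x) * Real.sinh (lam * f x)) / R = v at *
  have a1 : mu * u ≤ 1 := mul_le_one₀ hm1 u0 u1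
  have a2 : lam * v ≤ 1 := mul_le_one₀ hl1 v0 v1
  have a3 : 0 ≤ mu * u := by positivity
  have a4 : 0 ≤ lam * v := by positivity
  rw [abs_lt]
  constructor <;> nlinarith
end

section
/- Fix positive reals a, b and λ, μ ∈ [0, 1]. For x > 0 let y(x) = arcosh((cosh a + cosh b·cosh x)/(sinh b·sinh x)) and z(x) = arcosh((cosh b + cosh a·cosh x)/(sinh a·sinh x)), and define S(x) = arcosh(cosh(μ·z(x)) · cosh(λ·y(x)) · cosh x − sinh(μ·z(x)) · sinh(λ·y(x))). Then for every x > 0, S is differentiable at x and |S'(x)| < 4·coth x. -/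
theorem aux_arcosh_deriv {f : ℝ → ℝ} {f' x : ℝ} (hf : HasDerivAt f f' x) (h1 : 1 < f x) :
    HasDerivAt (fun t => arcosh (f t)) (f' / Real.sqrt (f x ^ 2 - 1)) x := by
  have h := (Real.hasDerivAt_arcosh (x := f x) h1).comp x hf
  rw [div_eq_inv_mul]
  exact h

theorem aux_side (a b x : ℝ) (ha : 0 < a) (hb : 0 < b) (hx : 0 < x) :
    ∃ d, HasDerivAt (fun x => arcosh ((Real.cosh b + Real.cosh a * Real.cosh x) /
                (Real.sinh a * Real.sinh x))) d x ∧ |d| ≤ Real.cosh x / Real.sinh x := by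
  have hsa : 0 < Real.sinh a := Real.sinh_pos_iff.2 ha
  have hsx : 0 < Real.sinh x := Real.sinh_pos_iff.2 hx
  have hca := Real.cosh_pos a
  have hcb := Real.cosh_pos b
  have hcx := Real.cosh_pos x
  have ea := Real.cosh_sq a
  have ex := Real.cosh_sq x
  have hsub := Real.cosh_sub a x
  have hpos := Real.cosh_pos (a - x)
  have hf : HasDerivAt (fun x => (Real.cosh b + Real.cosh a * Real.cosh x) /
                (Real.sinh a * Real.sinh x))
      (-(Real.cosh a + Real.cosh b * Real.cosh x) / (Real.sinh a * Real.sinh x ^ 2)) x := by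
    have h := (((Real.hasDerivAt_cosh x).const_mul (Real.cosh a)).const_add (Real.cosh b)).div
      ((Real.hasDerivAt_sinh x).const_mul (Real.sinh a)) (by positivity)
    refine h.congr_deriv ?_
    field_simp
    linear_combination (-Real.cosh a) * ex
  have h1 : 1 < (Real.cosh b + Real.cosh a * Real.cosh x) / (Real.sinh a * Real.sinh x) := by
    rw [one_lt_div (by positivity)]
    linarith
  refine ⟨_, aux_arcosh_deriv hf h1, ?_⟩
  have hr : 0 < ((Real.cosh b + Real.cosh a * Real.cosh x) / (Real.sinh a * Real.sinh x)) ^ 2 - 1 := by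
    nlinarith
  rw [abs_div, abs_of_pos (Real.sqrt_pos.2 hr), div_le_iff₀ (Real.sqrt_pos.2 hr)]
  apply abs_le_of_sq_le_sq _ (by positivity)
  rw [mul_pow, Real.sq_sqrt hr.le, ← sub_nonneg]
  have key : (Real.cosh x / Real.sinh x) ^ 2 * (((Real.cosh b + Real.cosh a * Real.cosh x) / (Real.sinh a * Real.sinh x)) ^ 2 - 1) - (-(Real.cosh a + Real.cosh b * Real.cosh x) / (Real.sinh a * Real.sinh x ^ 2)) ^ 2
    = (Real.cosh a ^ 2 + 2 * Real.cosh a * Real.cosh b * Real.cosh x + Real.cosh x ^ 2) / (Real.sinh a ^ 2 * Real.sinh x ^ 2) := by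
    have ea' : Real.sinh a ^ 2 = Real.cosh a ^ 2 - 1 := by linarith
    have ex' : Real.sinh x ^ 2 = Real.cosh x ^ 2 - 1 := by linarith
    have n1 : Real.cosh a ^ 2 - 1 ≠ 0 := by rw [← ea']; positivity
    have n2 : Real.cosh x ^ 2 - 1 ≠ 0 := by rw [← ex']; positivity
    have e4 : (Real.sinh x ^ 2) ^ 2 = (Real.cosh x ^ 2 - 1) ^ 2 := by rw [ex']
    simp only [div_pow, mul_pow]
    rw [e4, ea', ex']
    field_simp
    ring
  rw [key]
  positivity

theorem aux_S (p q : ℝ → ℝ) (p' q' x : ℝ) (hx : 0 < x) (hp : HasDerivAt p p' x)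
    (hq : HasDerivAt q q' x) (hp' : |p'| ≤ Real.cosh x / Real.sinh x)
    (hq' : |q'| ≤ Real.cosh x / Real.sinh x) :
    ∃ d, HasDerivAt (fun x => arcosh (Real.cosh (p x) * Real.cosh (q x) * Real.cosh x
      - Real.sinh (p x) * Real.sinh (q x))) d x ∧ |d| < 4 * (Real.cosh x / Real.sinh x) := by
  have hsx : 0 < Real.sinh x := Real.sinh_pos_iff.2 hx
  have hcx : 1 < Real.cosh x := Real.one_lt_cosh.2 hx.ne'
  have hf := ((hp.cosh.mul hq.cosh).mul (Real.hasDerivAt_cosh x)).sub (hp.sinh.mul hq.sinh)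
  have hcp := Real.cosh_pos (p x)
  have hcq := Real.cosh_pos (q x)
  have ep := Real.cosh_sq (p x)
  have eq := Real.cosh_sq (q x)
  have ex := Real.cosh_sq x
  have hsub := Real.cosh_sub (p x) (q x)
  have hpos := Real.one_le_cosh (p x - q x)
  have hA : 0 < Real.cosh (p x) * Real.cosh (q x) * (Real.cosh x - 1) :=
    mul_pos (mul_pos hcp hcq) (by linarith)
  have h1 : 1 < Real.cosh (p x) * Real.cosh (q x) * Real.cosh x
      - Real.sinh (p x) * Real.sinh (q x) := by linarith
  refine ⟨_, aux_arcosh_deriv hf h1, ?_⟩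
  simp only [Pi.mul_apply, Pi.sub_apply]
  set P := Real.cosh (p x)
  set Q := Real.cosh (q x)
  set P1 := Real.sinh (p x)
  set Q1 := Real.sinh (q x)
  set c := Real.cosh x
  set s := Real.sinh x
  have hr : 0 < (P * Q * c - P1 * Q1) ^ 2 - 1 := by nlinarith
  set R := Real.sqrt ((P * Q * c - P1 * Q1) ^ 2 - 1) with hR
  have hRp : 0 < R := Real.sqrt_pos.2 hr
  have hR2 : R ^ 2 = (P * Q * c - P1 * Q1) ^ 2 - 1 := Real.sq_sqrt hr.le
  have b1 : |P1 * Q * c - P * Q1| ≤ R := by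
    apply abs_le_of_sq_le_sq _ hRp.le
    have : R ^ 2 - (P1 * Q * c - P * Q1) ^ 2 = (Q * s) ^ 2 := by
      rw [hR2]
      linear_combination (Q^2*c^2 - Q1^2) * ep + eq + Q^2 * ex
    nlinarith [sq_nonneg (Q * s)]
  have b2 : |P * Q1 * c - P1 * Q| ≤ R := by
    apply abs_le_of_sq_le_sq _ hRp.le
    have : R ^ 2 - (P * Q1 * c - P1 * Q) ^ 2 = (P * s) ^ 2 := by
      rw [hR2]
      linear_combination (P^2*c^2 - P1^2) * eq + ep + P^2 * ex
    nlinarith [sq_nonneg (P * s)]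
  have b3 : P * Q * (c - 1) ≤ R := by
    refine le_trans (le_abs_self _) (abs_le_of_sq_le_sq ?_ hRp.le)
    rw [hR2]
    nlinarith
  have b4 : P * Q * s ≤ R * ((c + 1) / s) := by
    rw [mul_div_assoc', le_div_iff₀ hsx]
    nlinarith
  have b5 : (c + 1) / s < 2 * (c / s) := by
    rw [mul_div_assoc', div_lt_div_iff_of_pos_right hsx]
    linarith
  have hk : 0 < c / s := by positivity
  rw [abs_div, abs_of_pos hRp, div_lt_iff₀ hRp]
  have e : ∀ t, t = p' * (P1 * Q * c - P * Q1) + q' * (P * Q1 * c - P1 * Q) + P * Q * s →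
      |t| < 4 * (c / s) * R := by
    intro t ht
    have m1 : |p' * (P1 * Q * c - P * Q1)| ≤ c / s * R := by
      rw [abs_mul]; exact mul_le_mul hp' b1 (abs_nonneg _) hk.le
    have m2 : |q' * (P * Q1 * c - P1 * Q)| ≤ c / s * R := by
      rw [abs_mul]; exact mul_le_mul hq' b2 (abs_nonneg _) hk.le
    have m3 : |P * Q * s| ≤ R * ((c + 1) / s) := by
      rw [abs_of_pos (by positivity)]; exact b4
    have m4 := mul_lt_mul_of_pos_left b5 hRp
    rw [ht]
    have t1 := abs_add_le (p' * (P1 * Q * c - P * Q1) + q' * (P * Q1 * c - P1 * Q)) (P * Q * s)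
    have t2 := abs_add_le (p' * (P1 * Q * c - P * Q1)) (q' * (P * Q1 * c - P1 * Q))
    linarith
  apply e
  ring

theorem aux_scale {k d K : ℝ} (hk : k ∈ Set.Icc (0 : ℝ) 1) (h : |d| ≤ K) : |k * d| ≤ K := by
  rw [abs_mul, abs_of_nonneg hk.1]
  nlinarith [abs_nonneg d, hk.1, hk.2]

theorem stmt_16 (a b lam mu : ℝ) (ha : 0 < a) (hb : 0 < b)
    (hlam : lam ∈ Set.Icc (0 : ℝ) 1) (hmu : mu ∈ Set.Icc (0 : ℝ) 1) :
    ∀ x > (0 : ℝ),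
      DifferentiableAt ℝ
        (fun x : ℝ =>
          arcosh
            (Real.cosh (mu * arcosh ((Real.cosh b + Real.cosh a * Real.cosh x) /
                (Real.sinh a * Real.sinh x))) *
              Real.cosh (lam * arcosh ((Real.cosh a + Real.cosh b * Real.cosh x) /
                (Real.sinh b * Real.sinh x))) * Real.cosh x -
            Real.sinh (mu * arcosh ((Real.cosh b + Real.cosh a * Real.cosh x) /
                (Real.sinh a * Real.sinh x))) *
              Real.sinh (lam * arcosh ((Real.cosh a + Real.cosh b * Real.cosh x) /
                (Real.sinh b * Real.sinh x))))) x ∧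
      |deriv (fun x : ℝ =>
          arcosh
            (Real.cosh (mu * arcosh ((Real.cosh b + Real.cosh a * Real.cosh x) /
                (Real.sinh a * Real.sinh x))) *
              Real.cosh (lam * arcosh ((Real.cosh a + Real.cosh b * Real.cosh x) /
                (Real.sinh b * Real.sinh x))) * Real.cosh x -
            Real.sinh (mu * arcosh ((Real.cosh b + Real.cosh a * Real.cosh x) /
                (Real.sinh a * Real.sinh x))) *
              Real.sinh (lam * arcosh ((Real.cosh a + Real.cosh b * Real.cosh x) /
                (Real.sinh b * Real.sinh x))))) x| < 4 * coth x := by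
  intro x hx
  obtain ⟨d1, h1, g1⟩ := aux_side a b x ha hb hx
  obtain ⟨d2, h2, g2⟩ := aux_side b a x hb ha hx
  obtain ⟨d, h, g⟩ := aux_S _ _ _ _ x hx (h1.const_mul mu) (h2.const_mul lam)
    (aux_scale hmu g1) (aux_scale hlam g2)
  refine ⟨h.differentiableAt, ?_⟩
  have e := h.deriv
  rw [e]
  exact g
end

section
/- Fix positive reals a, b and λ, μ ∈ [0, 1]. For x > 0 let w(x) = arcosh((cosh x + cosh a·cosh b)/(sinh a·sinh b)), and define S(x) = arcosh(cosh(μ·b) · cosh(λ·a) · cosh(w(x)) − sinh(μ·b) · sinh(λ·a)). Then for every x > 0, S is differentiable at x and 0 < S'(x) < 2·coth x. -/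
theorem key_hasDeriv (a b p q : ℝ) (ha : 0 < a) (hb : 0 < b) (x : ℝ) (hx : 0 < x) :
    ∃ d : ℝ, HasDerivAt (fun x : ℝ =>
          arcosh
            (Real.cosh p * Real.cosh q *
              Real.cosh (arcosh ((Real.cosh x + Real.cosh a * Real.cosh b) /
                (Real.sinh a * Real.sinh b))) -
            Real.sinh p * Real.sinh q)) d x ∧ 0 < d ∧ d < 2 * coth x := by
  have hsa : 0 < Real.sinh a := Real.sinh_pos_iff.2 ha
  have hsb : 0 < Real.sinh b := Real.sinh_pos_iff.2 hb
  have hs : 0 < Real.sinh x := Real.sinh_pos_iff.2 hx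
  have hC : 0 < Real.cosh x := Real.cosh_pos x
  have hP : 0 < Real.sinh a * Real.sinh b := mul_pos hsa hsb
  have hA : 0 < Real.cosh p * Real.cosh q := mul_pos (Real.cosh_pos p) (Real.cosh_pos q)
  have hab : Real.sinh a * Real.sinh b < Real.cosh a * Real.cosh b :=
    mul_lt_mul'' (Real.sinh_lt_cosh a) (Real.sinh_lt_cosh b) hsa.le hsb.le
  have hpq : 1 ≤ Real.cosh p * Real.cosh q - Real.sinh p * Real.sinh q := by
    rw [← Real.cosh_sub]; exact Real.one_le_cosh _
  have hfun : (fun x : ℝ =>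
          arcosh
            (Real.cosh p * Real.cosh q *
              Real.cosh (arcosh ((Real.cosh x + Real.cosh a * Real.cosh b) /
                (Real.sinh a * Real.sinh b))) -
            Real.sinh p * Real.sinh q)) = fun x : ℝ => Real.arcosh
            (Real.cosh p * Real.cosh q * ((Real.cosh x + Real.cosh a * Real.cosh b) /
                (Real.sinh a * Real.sinh b)) -
            Real.sinh p * Real.sinh q) := by
    funext y
    rw [arcosh_eq_real, arcosh_eq_real, Real.cosh_arcosh]
    rw [le_div_iff₀ hP]
    linarith [Real.cosh_pos y]
  rw [hfun]
  have hin : HasDerivAt (fun x : ℝ => Real.cosh p * Real.cosh q *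
      ((Real.cosh x + Real.cosh a * Real.cosh b) / (Real.sinh a * Real.sinh b)) -
            Real.sinh p * Real.sinh q)
      (Real.cosh p * Real.cosh q * (Real.sinh x / (Real.sinh a * Real.sinh b))) x :=
    ((((Real.hasDerivAt_cosh x).add_const _).div_const _).const_mul _).sub_const _
  set A := Real.cosh p * Real.cosh q with hAdef
  set P := Real.sinh a * Real.sinh b with hPdef
  set F := A * ((Real.cosh x + Real.cosh a * Real.cosh b) / P) - Real.sinh p * Real.sinh q
    with hF
  have hk : 0 < A / P := div_pos hA hP
  have hFC : A / P * Real.cosh x + 1 < F := by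
    have h1 : 1 < (Real.cosh a * Real.cosh b) / P := (one_lt_div hP).2 hab
    have h2 : F = A / P * Real.cosh x + A * ((Real.cosh a * Real.cosh b) / P)
      - Real.sinh p * Real.sinh q := by rw [hF]; ring
    nlinarith
  have hkC : 0 < A / P * Real.cosh x := mul_pos hk hC
  have hF1 : 1 < F := by linarith
  have hR : A / P * Real.cosh x < √(F ^ 2 - 1) := by
    apply Real.lt_sqrt_of_sq_lt
    nlinarith
  have hR0 := hkC.trans hR
  have hcomp := HasDerivAt.comp (h₂ := Real.arcosh) x (Real.hasDerivAt_arcosh (x := F) hF1) hin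
  refine ⟨_, hcomp, ?_, ?_⟩
  · positivity
  · unfold coth
    rw [inv_mul_eq_div, div_lt_iff₀ hR0]
    have hsc := Real.sinh_lt_cosh x
    have e : A * (Real.sinh x / P) = A / P * Real.sinh x := by ring
    have h1 : 1 < Real.cosh x / Real.sinh x := (one_lt_div hs).2 hsc
    rw [e]
    nlinarith [mul_lt_mul_of_pos_left hsc hk, mul_lt_mul_of_pos_right h1 hR0]

theorem stmt_18 (a b lam mu : ℝ) (ha : 0 < a) (hb : 0 < b)
    (hlam : lam ∈ Set.Icc (0 : ℝ) 1) (hmu : mu ∈ Set.Icc (0 : ℝ) 1) :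
    ∀ x > (0 : ℝ),
      DifferentiableAt ℝ
        (fun x : ℝ =>
          arcosh
            (Real.cosh (mu * b) * Real.cosh (lam * a) *
              Real.cosh (arcosh ((Real.cosh x + Real.cosh a * Real.cosh b) /
                (Real.sinh a * Real.sinh b))) -
            Real.sinh (mu * b) * Real.sinh (lam * a))) x ∧
      0 < deriv (fun x : ℝ =>
          arcosh
            (Real.cosh (mu * b) * Real.cosh (lam * a) *
              Real.cosh (arcosh ((Real.cosh x + Real.cosh a * Real.cosh b) /
                (Real.sinh a * Real.sinh b))) -
            Real.sinh (mu * b) * Real.sinh (lam * a))) x ∧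
      deriv (fun x : ℝ =>
          arcosh
            (Real.cosh (mu * b) * Real.cosh (lam * a) *
              Real.cosh (arcosh ((Real.cosh x + Real.cosh a * Real.cosh b) /
                (Real.sinh a * Real.sinh b))) -
            Real.sinh (mu * b) * Real.sinh (lam * a))) x < 2 * coth x := by
  intro x hx
  obtain ⟨d, hd, h0, h1⟩ := key_hasDeriv a b (mu * b) (lam * a) ha hb x hx
  refine ⟨hd.differentiableAt, ?_, ?_⟩
  · rw [hd.deriv]; exact h0
  · rw [hd.deriv]; exact h1
end
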